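/- Let φ: X → ℝ be a bounded continuous function for which there exist M > 0 and a neighborhood U of the identity in SL(2,ℝ) such that |φ(h·y) − φ(y)| ≤ M‖h − I‖ for all h ∈ U and all y ∈ X. Fix x ∈ X and 0 < α < 1, and for t ≥ 0 set α_t = arctan(α e^{−2t}) and f_t(θ) = φ(g_t r_θ · x) − φ(g_t r_{θ + α_t} · x). Then there exist constants λ > 0 and C > 0 such that for all s, t ≥ 0, ∫₀^{2π} f_t(θ) f_s(θ) dθ ≤ C e^{−λ|s − t|}. -/

import Mathlib

open MeasureTheory Filter Topology Matrix Real

/-- `SL(2,ℝ)`: the group of 2×2 real matrices of determinant 1. -/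
abbrev SL2 : Type := Matrix.SpecialLinearGroup (Fin 2) ℝ

/-- The topology on `SL(2,ℝ)` induced from the space of 2×2 real matrices. -/
noncomputable instance : TopologicalSpace SL2 :=
  TopologicalSpace.induced (fun g : SL2 => (g : Matrix (Fin 2) (Fin 2) ℝ)) inferInstance

/-- The diagonal matrix `g_t = [[eᵗ, 0], [0, e⁻ᵗ]]` as an element of `SL(2,ℝ)`. -/
noncomputable def gMat (t : ℝ) : SL2 :=
  ⟨!![Real.exp t, 0; 0, Real.exp (-t)], by
    simp [Matrix.det_fin_two_of, ← Real.exp_add]⟩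

/-- The rotation matrix `r_θ = [[cos θ, sin θ], [−sin θ, cos θ]]` as an element of `SL(2,ℝ)`. -/
noncomputable def rMat (θ : ℝ) : SL2 :=
  ⟨!![Real.cos θ, Real.sin θ; -Real.sin θ, Real.cos θ], by
    simp [Matrix.det_fin_two_of]; nlinarith [Real.sin_sq_add_cos_sq θ]⟩

/-- The operator norm of a 2×2 real matrix (as an operator on Euclidean ℝ²). -/
noncomputable def opNorm2 (m : Matrix (Fin 2) (Fin 2) ℝ) : ℝ :=
  ‖Matrix.toEuclideanCLM (𝕜 := ℝ) m‖

/-- A bounded periodic function differenced at scale `a`, integrated against a Lipschitz periodic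
function differenced at any scale, gives an integral of size `O(a)`. -/
theorem integral_sub_mul_sub_le {F G : ℝ → ℝ} {T B L : ℝ} (hT : 0 ≤ T) (hF : Continuous F)
    (hG : Continuous G) (hFp : Function.Periodic F T) (hGp : Function.Periodic G T)
    (hFB : ∀ θ, |F θ| ≤ B) (hGL : ∀ θ δ, |G (θ + δ) - G θ| ≤ L * |δ|) (a b : ℝ) :
    (∫ θ in (0 : ℝ)..T, (F θ - F (θ + a)) * (G θ - G (θ + b))) ≤ B * (2 * (L * |a|)) * T := by
  have hshift : (∫ θ in (0 : ℝ)..T, F (θ + a) * (G θ - G (θ + b)))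
      = ∫ θ in (0 : ℝ)..T, F θ * (G (θ - a) - G (θ - a + b)) := by
    have hper : Function.Periodic (fun θ => F θ * (G (θ - a) - G (θ - a + b))) T := fun θ => by
      have h₁ : G (θ + T - a) = G (θ - a) := by rw [← hGp (θ - a)]; ring_nf
      have h₂ : G (θ + T - a + b) = G (θ - a + b) := by rw [← hGp (θ - a + b)]; ring_nf
      simp only [hFp θ, h₁, h₂]
    have := intervalIntegral.integral_comp_add_right (a := 0) (b := T)
      (fun θ => F θ * (G (θ - a) - G (θ - a + b))) a
    simp only [add_sub_cancel_right] at this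
    rw [this, add_comm T a, zero_add, hper.intervalIntegral_add_eq a 0, zero_add]
  have hrw : (∫ θ in (0 : ℝ)..T, (F θ - F (θ + a)) * (G θ - G (θ + b)))
      = ∫ θ in (0 : ℝ)..T, F θ * ((G θ - G (θ - a)) - (G (θ + b) - G (θ - a + b))) := by
    simp only [sub_mul (F _)]
    rw [intervalIntegral.integral_sub (Continuous.intervalIntegrable (by fun_prop) _ _)
      (Continuous.intervalIntegrable (by fun_prop) _ _), hshift,
      ← intervalIntegral.integral_sub (Continuous.intervalIntegrable (by fun_prop) _ _)
      (Continuous.intervalIntegrable (by fun_prop) _ _)]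
    congr 1 with θ
    ring
  have hbound : ∀ θ, ‖F θ * ((G θ - G (θ - a)) - (G (θ + b) - G (θ - a + b)))‖
      ≤ B * (2 * (L * |a|)) := fun θ => by
    have h₁ := hGL (θ - a) a
    have h₂ := hGL (θ - a + b) a
    rw [sub_add_cancel] at h₁
    rw [show θ - a + b + a = θ + b by ring] at h₂
    rw [Real.norm_eq_abs, abs_mul]
    refine mul_le_mul (hFB θ) ?_ (abs_nonneg _) ((abs_nonneg _).trans (hFB θ))
    linarith [abs_sub (G θ - G (θ - a)) (G (θ + b) - G (θ - a + b))]
  rw [hrw]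
  refine (le_abs_self _).trans ?_
  simpa [abs_of_nonneg hT] using
    intervalIntegral.norm_integral_le_of_norm_le_const (a := 0) (b := T) fun θ _ => hbound θ

theorem opNorm2_le_of_entry_le {m : Matrix (Fin 2) (Fin 2) ℝ} {c : ℝ} (hm : ∀ i j, |m i j| ≤ c) :
    opNorm2 m ≤ 2 * c := by
  have hc : 0 ≤ c := (abs_nonneg _).trans (hm 0 0)
  refine ContinuousLinearMap.opNorm_le_bound _ (by positivity) fun v => ?_
  refine le_of_sq_le_sq ?_ (by positivity)
  have hrow : ∀ i, (m i 0 * v 0 + m i 1 * v 1) ^ 2 ≤ 2 * c ^ 2 * (v 0 ^ 2 + v 1 ^ 2) := fun i => by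
    have h₀ : m i 0 ^ 2 ≤ c ^ 2 := sq_le_sq' (abs_le.1 (hm i 0)).1 (abs_le.1 (hm i 0)).2
    have h₁ : m i 1 ^ 2 ≤ c ^ 2 := sq_le_sq' (abs_le.1 (hm i 1)).1 (abs_le.1 (hm i 1)).2
    nlinarith [sq_nonneg (m i 0 * v 1 - m i 1 * v 0),
      mul_le_mul_of_nonneg_right (add_le_add h₀ h₁) (add_nonneg (sq_nonneg (v 0)) (sq_nonneg (v 1)))]
  have hnorm : ‖Matrix.toEuclideanCLM (𝕜 := ℝ) m v‖ ^ 2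
      = (m 0 0 * v 0 + m 0 1 * v 1) ^ 2 + (m 1 0 * v 0 + m 1 1 * v 1) ^ 2 := by
    simp [EuclideanSpace.norm_sq_eq, Fin.sum_univ_two, Matrix.ofLp_toEuclideanCLM,
      Matrix.mulVec, dotProduct]
  have hv : ‖v‖ ^ 2 = v 0 ^ 2 + v 1 ^ 2 := by
    simp [EuclideanSpace.norm_sq_eq, Fin.sum_univ_two]
  rw [hnorm, mul_pow, hv]
  linarith [hrow 0, hrow 1]

theorem exists_entry_ball_subset {U : Set SL2} (hU : U ∈ 𝓝 (1 : SL2)) :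
    ∃ ε > (0 : ℝ), ∀ h : SL2,
      (∀ i j, |((h : Matrix (Fin 2) (Fin 2) ℝ) - 1) i j| < ε) → h ∈ U := by
  rw [nhds_induced] at hU
  obtain ⟨V, hV, hVU⟩ := hU
  obtain ⟨ε, hε, hball⟩ := Metric.mem_nhds_iff (α := Fin 2 → Fin 2 → ℝ).1 hV
  refine ⟨ε, hε, fun h hh => hVU (hball ?_)⟩
  exact (dist_pi_lt_iff hε).2 fun i => (dist_pi_lt_iff hε).2 fun j => hh i j

theorem coe_gMat (t : ℝ) :
    (gMat t : Matrix (Fin 2) (Fin 2) ℝ) = !![Real.exp t, 0; 0, Real.exp (-t)] := rfl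

theorem coe_rMat (θ : ℝ) : (rMat θ : Matrix (Fin 2) (Fin 2) ℝ)
    = !![Real.cos θ, Real.sin θ; -Real.sin θ, Real.cos θ] := rfl

theorem continuous_rMat : Continuous rMat := by
  refine continuous_induced_rng.2 (continuous_matrix fun i j => ?_)
  fin_cases i <;> fin_cases j <;> simp [rMat] <;> fun_prop

theorem rMat_periodic : Function.Periodic rMat (2 * π) := fun θ =>
  Subtype.ext (by simp only [coe_rMat, Real.cos_add_two_pi, Real.sin_add_two_pi])

theorem rMat_add (θ δ : ℝ) : rMat (θ + δ) = rMat δ * rMat θ := by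
  refine Subtype.ext ?_
  rw [Matrix.SpecialLinearGroup.coe_mul]
  simp only [coe_rMat, Real.cos_add, Real.sin_add]
  ext i j
  fin_cases i <;> fin_cases j <;> simp [Matrix.mul_apply, Fin.sum_univ_two] <;> ring

/-- Conjugating `r_δ` by `g_t` moves it away from the identity by at most `e^{2t}|δ|`. -/
theorem abs_gMat_conj_rMat_sub_one_le {t : ℝ} (ht : 0 ≤ t) (δ : ℝ) (i j : Fin 2) :
    |((gMat t * rMat δ * (gMat t)⁻¹ : SL2) - 1 : Matrix (Fin 2) (Fin 2) ℝ) i j|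
      ≤ Real.exp (2 * t) * |δ| := by
  have h1 : 1 ≤ Real.exp (2 * t) := Real.one_le_exp (by linarith)
  have h2 : Real.exp (-(2 * t)) ≤ Real.exp (2 * t) := Real.exp_le_exp.2 (by linarith)
  have hsin : |Real.sin δ| ≤ |δ| := Real.abs_sin_le_abs
  have hcos : |Real.cos δ - 1| ≤ Real.exp (2 * t) * |δ| := by
    have h := Real.abs_cos_sub_cos_le δ 0
    simp only [Real.cos_zero, sub_zero] at h
    nlinarith [abs_nonneg δ]
  have e1 : Real.exp t * Real.exp (-t) = 1 := by rw [← Real.exp_add]; simp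
  have e2 : Real.exp t * Real.exp t = Real.exp (2 * t) := by rw [← Real.exp_add]; ring_nf
  have e3 : Real.exp (-t) * Real.exp (-t) = Real.exp (-(2 * t)) := by
    rw [← Real.exp_add]; ring_nf
  have hmat : ((gMat t * rMat δ * (gMat t)⁻¹ : SL2) : Matrix (Fin 2) (Fin 2) ℝ)
      = !![Real.cos δ, Real.exp (2 * t) * Real.sin δ;
          -(Real.exp (-(2 * t)) * Real.sin δ), Real.cos δ] := by
    rw [← e2, ← e3, Matrix.SpecialLinearGroup.coe_mul, Matrix.SpecialLinearGroup.coe_mul,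
      Matrix.SpecialLinearGroup.coe_inv, coe_gMat, coe_rMat]
    ext i j
    fin_cases i <;> fin_cases j <;>
      simp [Matrix.adjugate_fin_two, Matrix.mul_apply, Fin.sum_univ_two]
    · linear_combination Real.cos δ * e1
    · ring
    · ring
    · linear_combination Real.cos δ * e1
  rw [hmat]
  fin_cases i <;> fin_cases j
  · simpa using hcos
  · simpa [abs_mul] using mul_le_mul_of_nonneg_left hsin (Real.exp_pos (2 * t)).le
  · simpa [abs_mul] using mul_le_mul h2 hsin (abs_nonneg _) (Real.exp_pos _).le
  · simpa using hcos

/-- A bounded function that is Lipschitz in the group variable near the identity is globally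
Lipschitz, at scale `e^{-2t}`, along the curve `θ ↦ g_t r_θ x`. -/
theorem exists_lipschitz_along_circle {X : Type*} [MulAction SL2 X] {φ : X → ℝ} {B : ℝ}
    (hB : ∀ y, |φ y| ≤ B) {M : ℝ} (hM : 0 < M) {U : Set SL2} (hU : U ∈ 𝓝 (1 : SL2))
    (hlip : ∀ h ∈ U, ∀ y : X,
      |φ (h • y) - φ y| ≤ M * opNorm2 ((h : Matrix (Fin 2) (Fin 2) ℝ) - 1)) (x : X) :
    ∃ K > (0 : ℝ), ∀ t, 0 ≤ t → ∀ θ δ,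
      |φ ((gMat t * rMat (θ + δ)) • x) - φ ((gMat t * rMat θ) • x)|
        ≤ K * Real.exp (2 * t) * |δ| := by
  obtain ⟨ε, hε, hεU⟩ := exists_entry_ball_subset hU
  have hB0 : 0 ≤ B := (abs_nonneg _).trans (hB x)
  refine ⟨2 * M + 2 * B / ε, by positivity, fun t ht θ δ => ?_⟩
  have hent := abs_gMat_conj_rMat_sub_one_le ht δ
  have hd : 0 ≤ Real.exp (2 * t) * |δ| := by positivity
  rw [mul_assoc, add_mul]
  rcases lt_or_ge (Real.exp (2 * t) * |δ|) ε with hlt | hge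
  · have hmul : gMat t * rMat (θ + δ)
        = (gMat t * rMat δ * (gMat t)⁻¹) * (gMat t * rMat θ) := by
      rw [rMat_add]; group
    rw [hmul, mul_smul]
    have h := hlip _ (hεU _ fun i j => (hent i j).trans_lt hlt) ((gMat t * rMat θ) • x)
    have hop := mul_le_mul_of_nonneg_left (opNorm2_le_of_entry_le hent) hM.le
    have : 0 ≤ 2 * B / ε * (Real.exp (2 * t) * |δ|) := by positivity
    linarith
  · have h := abs_sub (φ ((gMat t * rMat (θ + δ)) • x)) (φ ((gMat t * rMat θ) • x))
    have h₁ := hB ((gMat t * rMat (θ + δ)) • x)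
    have h₂ := hB ((gMat t * rMat θ) • x)
    have h₃ : 2 * B ≤ 2 * B / ε * (Real.exp (2 * t) * |δ|) := by
      rw [div_mul_eq_mul_div, le_div_iff₀ hε]
      gcongr
    have : 0 ≤ 2 * M * (Real.exp (2 * t) * |δ|) := by positivity
    linarith

theorem abs_arctan_le {y : ℝ} (hy : 0 ≤ y) : |Real.arctan y| ≤ y := by
  rw [abs_of_nonneg (Real.arctan_nonneg.2 hy)]
  simpa [Real.tan_arctan] using
    Real.le_tan (Real.arctan_nonneg.2 hy) (Real.arctan_lt_pi_div_two y)

/-- With the same setup as Statement 2 (bounded continuous `φ`, Lipschitz in the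
group variable near the identity, `x ∈ X`, `0 < α < 1`, `α_t = arctan(α e^{−2t})` and
`f_t(θ) = φ(g_t r_θ · x) − φ(g_t r_{θ+α_t} · x)`), there exist `λ > 0` and `C > 0` such that
`∫₀^{2π} f_t(θ) f_s(θ) dθ ≤ C e^{−λ|s−t|}` for all `s, t ≥ 0`. -/
theorem stmt3 {X : Type*} [TopologicalSpace X] [MulAction SL2 X]
    (hact : Continuous fun p : SL2 × X => p.1 • p.2)
    (φ : X → ℝ) (hφcont : Continuous φ) (hφbdd : ∃ B : ℝ, ∀ y : X, |φ y| ≤ B)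
    (M : ℝ) (hM : 0 < M) (U : Set SL2) (hU : U ∈ 𝓝 (1 : SL2))
    (hlip : ∀ h ∈ U, ∀ y : X,
      |φ (h • y) - φ y| ≤ M * opNorm2 ((h : Matrix (Fin 2) (Fin 2) ℝ) - 1))
    (x : X) (α : ℝ) (hα₀ : 0 < α) (hα₁ : α < 1) :
    ∃ lam > (0:ℝ), ∃ C > (0:ℝ), ∀ s : ℝ, 0 ≤ s → ∀ t : ℝ, 0 ≤ t →
      (∫ θ in (0:ℝ)..(2 * π),
          (φ ((gMat t * rMat θ) • x) -
              φ ((gMat t * rMat (θ + Real.arctan (α * Real.exp (-2 * t)))) • x)) *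
            (φ ((gMat s * rMat θ) • x) -
              φ ((gMat s * rMat (θ + Real.arctan (α * Real.exp (-2 * s)))) • x)))
        ≤ C * Real.exp (-lam * |s - t|) := by
  obtain ⟨B₀, hB₀⟩ := hφbdd
  obtain ⟨K, hK, hKlip⟩ := exists_lipschitz_along_circle hB₀ hM hU hlip x
  have hB0 : 0 ≤ B₀ := (abs_nonneg _).trans (hB₀ x)
  have hcont : ∀ t, Continuous fun θ => φ ((gMat t * rMat θ) • x) := fun t => by
    simp only [mul_smul]
    exact hφcont.comp (hact.comp (continuous_const.prodMk
      (hact.comp (continuous_rMat.prodMk continuous_const))))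
  have hper : ∀ t, Function.Periodic (fun θ => φ ((gMat t * rMat θ) • x)) (2 * π) :=
    fun t θ => by simp only [rMat_periodic θ]
  have key : ∀ s, 0 ≤ s → ∀ t b : ℝ,
      (∫ θ in (0 : ℝ)..(2 * π),
        (φ ((gMat t * rMat θ) • x) -
            φ ((gMat t * rMat (θ + Real.arctan (α * Real.exp (-2 * t)))) • x)) *
          (φ ((gMat s * rMat θ) • x) - φ ((gMat s * rMat (θ + b)) • x)))
        ≤ (4 * π * B₀ * K + 1) * Real.exp (-2 * (t - s)) := fun s hs t b => by
    refine (integral_sub_mul_sub_le (by positivity) (hcont t) (hcont s) (hper t) (hper s)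
      (fun _ => hB₀ _) (hKlip s hs) _ b).trans ?_
    have harc : |Real.arctan (α * Real.exp (-2 * t))| ≤ Real.exp (-2 * t) := by
      refine (abs_arctan_le (by positivity)).trans ?_
      exact mul_le_of_le_one_left (Real.exp_pos _).le hα₁.le
    have hexp : Real.exp (-2 * (t - s)) = Real.exp (2 * s) * Real.exp (-2 * t) := by
      rw [← Real.exp_add]; ring_nf
    rw [hexp]
    calc B₀ * (2 * (K * Real.exp (2 * s) * |Real.arctan (α * Real.exp (-2 * t))|)) * (2 * π)
        ≤ B₀ * (2 * (K * Real.exp (2 * s) * Real.exp (-2 * t))) * (2 * π) := by gcongr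
      _ = 4 * π * B₀ * K * (Real.exp (2 * s) * Real.exp (-2 * t)) := by ring
      _ ≤ _ := by gcongr; linarith
  refine ⟨2, two_pos, 4 * π * B₀ * K + 1, by positivity, fun s hs t ht => ?_⟩
  rcases le_total s t with hst | hts
  · rw [abs_sub_comm, abs_of_nonneg (sub_nonneg.2 hst)]
    exact key s hs t _
  · rw [abs_of_nonneg (sub_nonneg.2 hts)]
    refine le_of_eq_of_le ?_ (key t ht s (Real.arctan (α * Real.exp (-2 * t))))
    exact intervalIntegral.integral_congr fun θ _ => mul_comm _ _
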